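/- (Theorem A.2, hindsight policy gradient with transition rewards.) Let r : S × A × S → ℝ be a reward function of transitions, and for θ ∈ ℝ^d and s_0 ∈ S define the value V^θ(s_0) := Σ_{k=0}^∞ γ^k · Σ_{u∈S} Σ_{b∈A} Σ_{u'∈S} Jπ_k^θ(s_0;u,b,u')·r(u,b,u'). Then θ ↦ V^θ(s_0) is differentiable, and its gradient satisfies ∇_θ V^θ(s_0) = Σ_{t=0}^∞ γ^t · Σ_{s∈S} P_t^θ(s_0,s) · Σ_{a∈A} ∇_θ log π_θ(s,a) · ( Σ_{k=t}^∞ γ^{k−t} · Σ_{u∈S} Σ_{b∈A} Σ_{u'∈S} ĥ_{k−t}^θ(a|s,u,b,u')·Jπ_{k−t}^θ(s;u,b,u')·r(u,b,u') ), where all series converge absolutely. -/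

import Mathlib

open Finset

noncomputable section
open scoped Classical

/-- n-step state probabilities induced by a policy `π` and a transition kernel `p`:
`Pn 0 s s' = [s' = s]` and `Pn (n+1) s s' = ∑ a, π s a * ∑ s'', p s a s'' * Pn n s'' s'`. -/
def Pn {S A : Type*} [Fintype S] [Fintype A] (p : S → A → S → ℝ) (π : S → A → ℝ) :
    ℕ → S → S → ℝ
  | 0, s, s' => if s' = s then 1 else 0
  | n + 1, s, s' => ∑ a, π s a * ∑ s'', p s a s'' * Pn p π n s'' s'

/-- Action-conditioned n-step probabilities, defined for indices `n ≥ 1` by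
`Pa (n+1) s a s' = ∑ s'', p s a s'' * Pn n s'' s'` (the value at `n = 0` is irrelevant). -/
def Pa {S A : Type*} [Fintype S] [Fintype A] (p : S → A → S → ℝ) (π : S → A → ℝ) :
    ℕ → S → A → S → ℝ
  | 0, _, _, _ => 0
  | n + 1, s, a, s' => ∑ s'', p s a s'' * Pn p π n s'' s'

/-- Hindsight probability `h_n(a | s, s')`. -/
def hca {S A : Type*} [Fintype S] [Fintype A] (p : S → A → S → ℝ) (π : S → A → ℝ)
    (n : ℕ) (a : A) (s s' : S) : ℝ :=
  if 0 < Pn p π n s s' then π s a * Pa p π n s a s' / Pn p π n s s' else 0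

/-- n-step transition-occupancy probabilities under the policy:
`Jπ_n(s; u, b, u')`, with the Iverson-bracket convention at `n = 0`. -/
def Jpi {S A : Type*} [Fintype S] [Fintype A] (p : S → A → S → ℝ) (π : S → A → ℝ)
    (n : ℕ) (s u : S) (b : A) (u' : S) : ℝ :=
  if n = 0 then (if u = s then 1 else 0) * π s b * p s b u'
  else Pn p π n s u * π u b * p u b u'

/-- n-step transition-occupancy probabilities conditioned on the first action:
`Ja_n(s, a; u, b, u')`, with the Iverson-bracket convention at `n = 0`. -/
def Ja {S A : Type*} [Fintype S] [Fintype A] (p : S → A → S → ℝ) (π : S → A → ℝ)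
    (n : ℕ) (s : S) (a : A) (u : S) (b : A) (u' : S) : ℝ :=
  if n = 0 then (if u = s then 1 else 0) * (if b = a then 1 else 0) * p s a u'
  else Pa p π n s a u * π u b * p u b u'

/-- Transition-conditioned hindsight probability `ĥ_n(a | s, u, b, u')`. -/
def hhat {S A : Type*} [Fintype S] [Fintype A] (p : S → A → S → ℝ) (π : S → A → ℝ)
    (n : ℕ) (a : A) (s u : S) (b : A) (u' : S) : ℝ :=
  if 0 < Jpi p π n s u b u' then π s a * Ja p π n s a u b u' / Jpi p π n s u b u'
  else 0

/-- One-step state transition probabilities of the policy `π`. -/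
def stepProb {S A : Type*} [Fintype A] (p : S → A → S → ℝ) (π : S → A → ℝ) (s s' : S) : ℝ :=
  ∑ a, π s a * p s a s'

/-- Expected reward of the transition starting from `s` with action `a`. -/
def meanReward {S A : Type*} [Fintype S] (p r : S → A → S → ℝ) (s : S) (a : A) : ℝ :=
  ∑ s', p s a s' * r s a s'

lemma stepProb_nonneg {S A : Type*} [Fintype A] {p : S → A → S → ℝ} {π : S → A → ℝ}
    (hp0 : ∀ s a s', 0 ≤ p s a s') (hπ0 : ∀ s a, 0 ≤ π s a) (s s' : S) :
    0 ≤ stepProb p π s s' :=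
  sum_nonneg fun a _ => mul_nonneg (hπ0 s a) (hp0 s a s')

section Chain

variable {S A : Type*} [Fintype S] [Fintype A] {p : S → A → S → ℝ} {π : S → A → ℝ}

lemma Pn_succ (n : ℕ) (s s' : S) :
    Pn p π (n + 1) s s' = ∑ s'', stepProb p π s s'' * Pn p π n s'' s' := by
  simp only [Pn, stepProb, sum_mul, mul_sum]
  rw [sum_comm]
  simp only [mul_assoc]

lemma sum_stepProb (hp1 : ∀ s a, ∑ s', p s a s' = 1) (hπ1 : ∀ s, ∑ a, π s a = 1) (s : S) :
    ∑ s', stepProb p π s s' = 1 := by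
  simp only [stepProb]
  rw [sum_comm]
  simp only [← mul_sum, hp1, mul_one, hπ1]

lemma Pn_nonneg (hp0 : ∀ s a s', 0 ≤ p s a s') (hπ0 : ∀ s a, 0 ≤ π s a) (n : ℕ) (s s' : S) :
    0 ≤ Pn p π n s s' := by
  induction n generalizing s with
  | zero => simp only [Pn]; split_ifs <;> norm_num
  | succ n ih =>
    rw [Pn_succ]
    exact sum_nonneg fun x _ => mul_nonneg (stepProb_nonneg hp0 hπ0 s x) (ih x)

lemma Pn_le_one (hp0 : ∀ s a s', 0 ≤ p s a s') (hp1 : ∀ s a, ∑ s', p s a s' = 1)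
    (hπ0 : ∀ s a, 0 ≤ π s a) (hπ1 : ∀ s, ∑ a, π s a = 1) (n : ℕ) (s s' : S) :
    Pn p π n s s' ≤ 1 := by
  induction n generalizing s with
  | zero => simp only [Pn]; split_ifs <;> norm_num
  | succ n ih =>
    rw [Pn_succ, ← sum_stepProb hp1 hπ1 s]
    exact sum_le_sum fun x _ => mul_le_of_le_one_right (stepProb_nonneg hp0 hπ0 s x) (ih x)

lemma sum_Pn_succ_smul {E : Type*} [AddCommGroup E] [Module ℝ E] (G : S → E) (n : ℕ) (s : S) :
    ∑ u, Pn p π (n + 1) s u • G u =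
      ∑ s', stepProb p π s s' • ∑ u, Pn p π n s' u • G u := by
  simp only [Pn_succ, sum_smul, smul_sum, mul_smul]
  exact sum_comm

lemma summable_norm_discounted {E : Type*} [NormedAddCommGroup E] [NormedSpace ℝ E]
    (hp0 : ∀ s a s', 0 ≤ p s a s') (hp1 : ∀ s a, ∑ s', p s a s' = 1)
    (hπ0 : ∀ s a, 0 ≤ π s a) (hπ1 : ∀ s, ∑ a, π s a = 1)
    {γ : ℝ} (hγ0 : 0 ≤ γ) (hγ1 : γ < 1) (G : S → E) (s : S) :
    Summable fun t : ℕ => ‖γ ^ t • ∑ u, Pn p π t s u • G u‖ := by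
  refine Summable.of_nonneg_of_le (fun _ => norm_nonneg _) (fun t => ?_)
    ((summable_geometric_of_lt_one hγ0 hγ1).mul_right (∑ u, ‖G u‖))
  rw [norm_smul, Real.norm_of_nonneg (pow_nonneg hγ0 t)]
  gcongr
  refine norm_sum_le_of_le _ fun u _ => ?_
  rw [norm_smul, Real.norm_of_nonneg (Pn_nonneg hp0 hπ0 t s u)]
  exact mul_le_of_le_one_left (norm_nonneg _) (Pn_le_one hp0 hp1 hπ0 hπ1 t s u)

/-- A solution of the Bellman equation is the discounted sum of its source term. -/
lemma hasSum_discounted_of_bellman {E : Type*} [NormedAddCommGroup E] [NormedSpace ℝ E]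
    (hp0 : ∀ s a s', 0 ≤ p s a s') (hp1 : ∀ s a, ∑ s', p s a s' = 1)
    (hπ0 : ∀ s a, 0 ≤ π s a) (hπ1 : ∀ s, ∑ a, π s a = 1)
    {γ : ℝ} (hγ0 : 0 ≤ γ) (hγ1 : γ < 1) {G X : S → E}
    (hX : ∀ s, X s = G s + γ • ∑ s', stepProb p π s s' • X s') (s : S) :
    HasSum (fun t : ℕ => γ ^ t • ∑ u, Pn p π t s u • G u) (X s) := by
  have expand : ∀ n s, ∑ t ∈ range n, γ ^ t • ∑ u, Pn p π t s u • G u =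
      X s - γ ^ n • ∑ u, Pn p π n s u • X u := by
    intro n
    induction n with
    | zero => intro s; simp [Pn]
    | succ n ih =>
      intro s
      rw [sum_range_succ']
      simp only [sum_Pn_succ_smul, pow_succ', mul_smul]
      rw [← smul_sum]
      simp only [smul_comm (γ ^ _) (stepProb p π s _), smul_sum (r := γ ^ _) (s := univ)]
      rw [sum_comm]
      simp only [← smul_sum, ih, smul_sub, sum_sub_distrib]
      conv_rhs => rw [hX s]
      simp [Pn]
      abel
  rw [hasSum_iff_tendsto_nat_of_summable_norm
    (summable_norm_discounted hp0 hp1 hπ0 hπ1 hγ0 hγ1 G s)]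
  simp only [expand]
  have h0 := (summable_norm_discounted hp0 hp1 hπ0 hπ1 hγ0 hγ1 X s).tendsto_atTop_zero
  simpa using tendsto_const_nhds.sub (tendsto_zero_iff_norm_tendsto_zero.2 h0)

end Chain

section Value

variable {S A : Type*} [Fintype S] [Fintype A]

/-- The matrix `1 - γ M` of the Bellman equation. -/
def bellmanMatrix (p : S → A → S → ℝ) (π : S → A → ℝ) (γ : ℝ) : Matrix S S ℝ :=
  Matrix.of fun s s' => (if s = s' then 1 else 0) - γ * stepProb p π s s'

/-- The value function, as the solution of the Bellman equation given by Cramer's rule. -/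
def bellmanValue (p r : S → A → S → ℝ) (γ : ℝ) (π : S → A → ℝ) (s : S) : ℝ :=
  (bellmanMatrix p π γ).det⁻¹ *
    (bellmanMatrix p π γ).cramer (fun u => ∑ b, π u b * meanReward p r u b) s

variable {p : S → A → S → ℝ} {π : S → A → ℝ}

lemma det_bellmanMatrix_ne_zero
    (hp0 : ∀ s a s', 0 ≤ p s a s') (hp1 : ∀ s a, ∑ s', p s a s' = 1)
    (hπ0 : ∀ s a, 0 ≤ π s a) (hπ1 : ∀ s, ∑ a, π s a = 1)
    {γ : ℝ} (hγ0 : 0 ≤ γ) (hγ1 : γ < 1) : (bellmanMatrix p π γ).det ≠ 0 := by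
  refine det_ne_zero_of_sum_row_lt_diag fun s => ?_
  have hM := fun s' => mul_nonneg hγ0 (stepProb_nonneg hp0 hπ0 s s')
  have hoff : ∑ s' ∈ univ.erase s, ‖bellmanMatrix p π γ s s'‖ =
      ∑ s' ∈ univ.erase s, γ * stepProb p π s s' := by
    refine sum_congr rfl fun s' hs' => ?_
    rw [bellmanMatrix, Matrix.of_apply, if_neg (ne_of_mem_erase hs').symm, zero_sub, norm_neg,
      Real.norm_of_nonneg (hM s')]
  have hsum : γ * stepProb p π s s + ∑ s' ∈ univ.erase s, γ * stepProb p π s s' = γ := by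
    rw [add_sum_erase _ (fun s' => γ * stepProb p π s s') (mem_univ s), ← mul_sum,
      sum_stepProb hp1 hπ1, mul_one]
  rw [hoff]
  refine lt_of_lt_of_le ?_ (le_abs_self _)
  rw [bellmanMatrix, Matrix.of_apply, if_pos rfl]
  linarith

lemma bellmanValue_eq
    (hp0 : ∀ s a s', 0 ≤ p s a s') (hp1 : ∀ s a, ∑ s', p s a s' = 1)
    (hπ0 : ∀ s a, 0 ≤ π s a) (hπ1 : ∀ s, ∑ a, π s a = 1)
    {γ : ℝ} (hγ0 : 0 ≤ γ) (hγ1 : γ < 1) (r : S → A → S → ℝ) (s : S) :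
    bellmanValue p r γ π s = ∑ b, π s b * meanReward p r s b +
      γ * ∑ s', stepProb p π s s' * bellmanValue p r γ π s' := by
  have hdet := det_bellmanMatrix_ne_zero hp0 hp1 hπ0 hπ1 hγ0 hγ1
  have h := congrFun (Matrix.mulVec_cramer (bellmanMatrix p π γ)
    (fun u => ∑ b, π u b * meanReward p r u b)) s
  have hval : ∀ s', (bellmanMatrix p π γ).cramer (fun u => ∑ b, π u b * meanReward p r u b) s' =
      (bellmanMatrix p π γ).det * bellmanValue p r γ π s' := fun s' => by
    rw [bellmanValue, mul_inv_cancel_left₀ hdet]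
  simp only [Matrix.mulVec, dotProduct, hval, Pi.smul_apply, smul_eq_mul,
    mul_left_comm _ (bellmanMatrix p π γ).det, ← mul_sum] at h
  have h' := mul_left_cancel₀ hdet h
  simp only [bellmanMatrix, Matrix.of_apply, sub_mul, sum_sub_distrib, ite_mul, one_mul, zero_mul,
    sum_ite_eq, mem_univ, if_true, mul_assoc, ← mul_sum] at h'
  linarith

lemma differentiableAt_det {E : Type*} [NormedAddCommGroup E] [NormedSpace ℝ E]
    {B : E → Matrix S S ℝ} {x : E} (hB : ∀ i j, DifferentiableAt ℝ (fun y => B y i j) x) :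
    DifferentiableAt ℝ (fun y => (B y).det) x := by
  simp only [Matrix.det_apply']
  fun_prop

lemma differentiableAt_bellmanValue {E : Type*} [NormedAddCommGroup E] [NormedSpace ℝ E]
    {Pol : E → S → A → ℝ} {x : E} (hPol : ∀ s a, DifferentiableAt ℝ (fun y => Pol y s a) x)
    {γ : ℝ} (hdet : (bellmanMatrix p (Pol x) γ).det ≠ 0) (r : S → A → S → ℝ) (s : S) :
    DifferentiableAt ℝ (fun y => bellmanValue p r γ (Pol y) s) x := by
  have hM : ∀ i j, DifferentiableAt ℝ (fun y => bellmanMatrix p (Pol y) γ i j) x := by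
    intro i j
    simp only [bellmanMatrix, Matrix.of_apply, stepProb]
    fun_prop
  refine ((differentiableAt_det hM).inv hdet).mul ?_
  simp only [Matrix.cramer_apply]
  refine differentiableAt_det fun i j => ?_
  by_cases hj : j = s
  · simp only [Matrix.updateCol_apply, hj, if_true]
    fun_prop
  · simpa only [Matrix.updateCol_apply, hj, if_false] using hM i j

end Value

section Occupancy

variable {S A : Type*} [Fintype S] [Fintype A] {p : S → A → S → ℝ} {π : S → A → ℝ}

lemma Jpi_eq (n : ℕ) (s u : S) (b : A) (u' : S) :
    Jpi p π n s u b u' = Pn p π n s u * π u b * p u b u' := by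
  unfold Jpi
  split_ifs with hn hu
  · subst hn hu; simp [Pn]
  · subst hn; simp [Pn, hu]
  · rfl

lemma Ja_nonneg (hp0 : ∀ s a s', 0 ≤ p s a s') (hπ0 : ∀ s a, 0 ≤ π s a)
    (n : ℕ) (s : S) (a : A) (u : S) (b : A) (u' : S) : 0 ≤ Ja p π n s a u b u' := by
  cases n with
  | zero => simp only [Ja, if_true]; have := hp0 s a u'; split_ifs <;> simp [this]
  | succ n =>
    simp only [Ja, Pa, Nat.succ_ne_zero, if_false]
    exact mul_nonneg (mul_nonneg (sum_nonneg fun x _ =>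
      mul_nonneg (hp0 s a x) (Pn_nonneg hp0 hπ0 n x u)) (hπ0 u b)) (hp0 u b u')

lemma sum_policy_mul_Ja (n : ℕ) (s u : S) (b : A) (u' : S) :
    ∑ a, π s a * Ja p π n s a u b u' = Jpi p π n s u b u' := by
  cases n with
  | zero => simp only [Ja, Jpi, if_true]; split_ifs <;> simp
  | succ n => simp only [Ja, Jpi, Pn, Pa, Nat.succ_ne_zero, if_false, sum_mul, mul_assoc]

lemma hhat_mul_Jpi (hp0 : ∀ s a s', 0 ≤ p s a s') (hπ0 : ∀ s a, 0 ≤ π s a)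
    (n : ℕ) (a : A) (s u : S) (b : A) (u' : S) :
    hhat p π n a s u b u' * Jpi p π n s u b u' = π s a * Ja p π n s a u b u' := by
  have h0 := fun a => mul_nonneg (hπ0 s a) (Ja_nonneg hp0 hπ0 n s a u b u')
  have hle : π s a * Ja p π n s a u b u' ≤ Jpi p π n s u b u' := by
    rw [← sum_policy_mul_Ja]
    exact single_le_sum (f := fun a => π s a * Ja p π n s a u b u') (fun a _ => h0 a) (mem_univ a)
  unfold hhat
  split_ifs with h
  · exact div_mul_cancel₀ _ h.ne'
  · rw [zero_mul]
    exact le_antisymm (h0 a) (hle.trans (not_lt.1 h))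

lemma sum_Jpi_mul (r : S → A → S → ℝ) (n : ℕ) (s : S) :
    ∑ u, ∑ b, ∑ u', Jpi p π n s u b u' * r u b u' =
      ∑ u, Pn p π n s u • ∑ b, π u b * meanReward p r u b := by
  simp only [Jpi_eq, meanReward, smul_eq_mul, mul_sum, mul_assoc]

lemma sum_Ja_zero_mul (r : S → A → S → ℝ) (s : S) (a : A) :
    ∑ u, ∑ b, ∑ u', Ja p π 0 s a u b u' * r u b u' = meanReward p r s a := by
  simp only [Ja, if_true, mul_assoc, ← mul_sum]
  simp [meanReward]

lemma sum_Ja_succ_mul (r : S → A → S → ℝ) (n : ℕ) (s : S) (a : A) :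
    ∑ u, ∑ b, ∑ u', Ja p π (n + 1) s a u b u' * r u b u' =
      ∑ s', p s a s' * ∑ u, Pn p π n s' u • ∑ b, π u b * meanReward p r u b := by
  simp only [Ja, Pa, Nat.succ_ne_zero, if_false, meanReward, smul_eq_mul, mul_assoc, ← mul_sum]
  simp only [sum_mul]
  rw [sum_comm]
  simp only [mul_assoc, ← mul_sum]

/-- The hindsight-credited return of the first action `a` is `π(s, a) Q(s, a)`. -/
lemma hasSum_hindsight (hp0 : ∀ s a s', 0 ≤ p s a s') (hp1 : ∀ s a, ∑ s', p s a s' = 1)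
    (hπ0 : ∀ s a, 0 ≤ π s a) (hπ1 : ∀ s, ∑ a, π s a = 1)
    {γ : ℝ} (hγ0 : 0 ≤ γ) (hγ1 : γ < 1) (r : S → A → S → ℝ) (s : S) (a : A) :
    HasSum (fun j : ℕ => γ ^ j * ∑ u, ∑ b, ∑ u',
        hhat p π j a s u b u' * Jpi p π j s u b u' * r u b u')
      (π s a * (meanReward p r s a + γ * ∑ s', p s a s' * bellmanValue p r γ π s')) := by
  simp only [hhat_mul_Jpi hp0 hπ0, mul_assoc, ← mul_sum, mul_left_comm _ (π s a)]
  refine HasSum.mul_left _ ?_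
  rw [← hasSum_nat_add_iff' 1]
  simp only [sum_range_one, sum_Ja_zero_mul, sum_Ja_succ_mul, pow_zero, one_mul,
    add_sub_cancel_left, pow_succ', mul_assoc]
  refine HasSum.mul_left _ ?_
  convert hasSum_sum fun s' (_ : s' ∈ univ) =>
    (hasSum_discounted_of_bellman hp0 hp1 hπ0 hπ1 hγ0 hγ1
      (bellmanValue_eq hp0 hp1 hπ0 hπ1 hγ0 hγ1 r) s').mul_left (p s a s') using 2 with j
  rw [mul_sum]
  exact sum_congr rfl fun s' _ => mul_left_comm _ _ _

end Occupancy

/-- The gradient of the value function solves a Bellman equation. -/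
lemma fderiv_bellmanValue {S A E : Type*} [Fintype S] [Fintype A]
    [NormedAddCommGroup E] [NormedSpace ℝ E] {p : S → A → S → ℝ}
    (hp0 : ∀ s a s', 0 ≤ p s a s') (hp1 : ∀ s a, ∑ s', p s a s' = 1)
    {Pol : E → S → A → ℝ} (hPol0 : ∀ x s a, 0 ≤ Pol x s a) (hPol1 : ∀ x s, ∑ a, Pol x s a = 1)
    {γ : ℝ} (hγ0 : 0 ≤ γ) (hγ1 : γ < 1) (r : S → A → S → ℝ) {x : E}
    (hPol : ∀ s a, DifferentiableAt ℝ (fun y => Pol y s a) x) (s : S) :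
    fderiv ℝ (fun y => bellmanValue p r γ (Pol y) s) x =
      ∑ a, (meanReward p r s a + γ * ∑ s', p s a s' * bellmanValue p r γ (Pol x) s') •
        fderiv ℝ (fun y => Pol y s a) x +
      γ • ∑ s', stepProb p (Pol x) s s' •
        fderiv ℝ (fun y => bellmanValue p r γ (Pol y) s') x := by
  have hV := fun s' => (differentiableAt_bellmanValue hPol
    (det_bellmanMatrix_ne_zero hp0 hp1 (hPol0 x) (hPol1 x) hγ0 hγ1) r s').hasFDerivAt
  have hP := fun a => (hPol s a).hasFDerivAt
  have hbell : (fun y => bellmanValue p r γ (Pol y) s) = fun y => ∑ a, Pol y s a *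
      (meanReward p r s a + γ * ∑ s', p s a s' * bellmanValue p r γ (Pol y) s') := by
    funext y
    rw [bellmanValue_eq hp0 hp1 (hPol0 y) (hPol1 y) hγ0 hγ1]
    simp only [mul_add, sum_add_distrib, stepProb, sum_mul, mul_sum]
    rw [sum_comm]
    congr! 3
    ring
  have hD := HasFDerivAt.fun_sum (u := univ) fun a _ => (hP a).mul
    (((HasFDerivAt.fun_sum (u := univ) fun s' _ => (hV s').const_mul (p s a s')).const_mul
      γ).const_add (meanReward p r s a))
  conv_lhs => rw [hbell]
  refine hD.fderiv.trans ?_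
  rw [sum_add_distrib, add_comm]
  congr 1
  simp only [stepProb, sum_smul, smul_sum, smul_smul]
  rw [sum_comm]
  congr! 3
  ring

/-- Theorem A.2: hindsight policy gradient with transition rewards.
The value `V^θ(s₀) = ∑_k γ^k ∑_{u,b,u'} Jπ^θ_k(s₀;u,b,u') r(u,b,u')` converges
absolutely, is differentiable in `θ`, and its gradient is the hindsight-credited
policy-gradient series (with `j = k - t` indexing the lag), all series converging
absolutely. -/
theorem hindsight_policy_gradient_transition_rewards
    {S A : Type*} [Fintype S] [Fintype A] [Nonempty S] [Nonempty A]
    (p : S → A → S → ℝ)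
    (hp0 : ∀ s a s', 0 ≤ p s a s') (hp1 : ∀ s a, ∑ s', p s a s' = 1)
    (d : ℕ) (Pol : EuclideanSpace ℝ (Fin d) → S → A → ℝ)
    (hPolpos : ∀ θ s a, 0 < Pol θ s a) (hPol1 : ∀ θ s, ∑ a, Pol θ s a = 1)
    (hPoldiff : ∀ s a, ContDiff ℝ 1 fun θ => Pol θ s a)
    (γ : ℝ) (hγ0 : 0 ≤ γ) (hγ1 : γ < 1) (r : S → A → S → ℝ) (s₀ : S)
    (θ : EuclideanSpace ℝ (Fin d)) :
    Summable (fun k : ℕ =>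
      |γ ^ k * ∑ u, ∑ b, ∑ u', Jpi p (Pol θ) k s₀ u b u' * r u b u'|) ∧
    DifferentiableAt ℝ
      (fun θ' => ∑' k : ℕ,
        γ ^ k * ∑ u, ∑ b, ∑ u', Jpi p (Pol θ') k s₀ u b u' * r u b u') θ ∧
    (∀ (s : S) (a : A), Summable (fun j : ℕ =>
      |γ ^ j * ∑ u, ∑ b, ∑ u',
          hhat p (Pol θ) j a s u b u' * Jpi p (Pol θ) j s u b u' * r u b u'|)) ∧
    Summable (fun t : ℕ =>
      ‖(γ ^ t) • ∑ s, (Pn p (Pol θ) t s₀ s) • ∑ a,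
          (∑' j : ℕ, γ ^ j * ∑ u, ∑ b, ∑ u',
              hhat p (Pol θ) j a s u b u' * Jpi p (Pol θ) j s u b u' * r u b u') •
            fderiv ℝ (fun θ' => Real.log (Pol θ' s a)) θ‖) ∧
    fderiv ℝ
        (fun θ' => ∑' k : ℕ,
          γ ^ k * ∑ u, ∑ b, ∑ u', Jpi p (Pol θ') k s₀ u b u' * r u b u') θ =
      ∑' t : ℕ, (γ ^ t) • ∑ s, (Pn p (Pol θ) t s₀ s) • ∑ a,
        (∑' j : ℕ, γ ^ j * ∑ u, ∑ b, ∑ u',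
            hhat p (Pol θ) j a s u b u' * Jpi p (Pol θ) j s u b u' * r u b u') •
          fderiv ℝ (fun θ' => Real.log (Pol θ' s a)) θ := by
  have hPol0 := fun θ s a => (hPolpos θ s a).le
  have hdiff : ∀ s a, DifferentiableAt ℝ (fun θ' => Pol θ' s a) θ := fun s a =>
    (hPoldiff s a).differentiable one_ne_zero θ
  have hval : ∀ θ', HasSum (fun k : ℕ =>
      γ ^ k * ∑ u, ∑ b, ∑ u', Jpi p (Pol θ') k s₀ u b u' * r u b u')
      (bellmanValue p r γ (Pol θ') s₀) := fun θ' => by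
    simpa only [sum_Jpi_mul, smul_eq_mul] using
      hasSum_discounted_of_bellman hp0 hp1 (hPol0 θ') (hPol1 θ') hγ0 hγ1
        (bellmanValue_eq hp0 hp1 (hPol0 θ') (hPol1 θ') hγ0 hγ1 r) s₀
  have hhind := hasSum_hindsight hp0 hp1 (hPol0 θ) (hPol1 θ) hγ0 hγ1 r
  have hscore : ∀ s a, (∑' j : ℕ, γ ^ j * ∑ u, ∑ b, ∑ u',
        hhat p (Pol θ) j a s u b u' * Jpi p (Pol θ) j s u b u' * r u b u') •
          fderiv ℝ (fun θ' => Real.log (Pol θ' s a)) θ =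
      (meanReward p r s a + γ * ∑ s', p s a s' * bellmanValue p r γ (Pol θ) s') •
        fderiv ℝ (fun θ' => Pol θ' s a) θ := fun s a => by
    rw [(hhind s a).tsum_eq, fderiv.log (hdiff s a) (hPolpos θ s a).ne', smul_smul,
      mul_right_comm, mul_inv_cancel₀ (hPolpos θ s a).ne', one_mul]
  have hgrad := hasSum_discounted_of_bellman hp0 hp1 (hPol0 θ) (hPol1 θ) hγ0 hγ1
    (fderiv_bellmanValue hp0 hp1 hPol0 hPol1 hγ0 hγ1 r hdiff) s₀
  simp only [hscore, fun θ' => (hval θ').tsum_eq]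
  exact ⟨(hval θ).summable.abs,
    differentiableAt_bellmanValue hdiff
      (det_bellmanMatrix_ne_zero hp0 hp1 (hPol0 θ) (hPol1 θ) hγ0 hγ1) r s₀,
    fun s a => (hhind s a).summable.abs,
    summable_norm_discounted hp0 hp1 (hPol0 θ) (hPol1 θ) hγ0 hγ1 _ s₀,
    hgrad.tsum_eq.symm⟩

end
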